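/- Let p > 2 be prime, K a finite extension of Q_p, and χ: Z_p^* → K^* a continuous character. For an integer r ≥ 1, the map x ↦ χ(1 + p^{r+1}x) on Z_p is analytic (given by a single convergent power series) if |χ(1+p) − 1| < p^{-1/(p^{r-1}(p+1))}. -/

import Mathlib

open Filter Topology in
theorem Padic.tendsto_natCast_choose_prime_pow_sub_one (p : ℕ) [hp : Fact p.Prime] (n : ℕ) :
    Tendsto (fun m : ℕ => ((p ^ m - 1).choose n : ℚ_[p])) atTop (𝓝 ((-1) ^ n)) := by
  have hpm : Tendsto (fun m : ℕ => ((p : ℚ_[p])) ^ m) atTop (𝓝 0) :=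
    tendsto_pow_atTop_nhds_zero_of_norm_lt_one Padic.norm_p_lt_one
  induction n with
  | zero => simp
  | succ n ih =>
    have h : Tendsto (fun m : ℕ => (p : ℚ_[p]) ^ m * ((p ^ m - 1).choose n : ℚ_[p]) / (n + 1)
        - ((p ^ m - 1).choose n : ℚ_[p])) atTop (𝓝 ((-1) ^ (n + 1))) := by
      convert ((hpm.mul ih).div_const ((n : ℚ_[p]) + 1)).sub ih using 2
      ring
    refine h.congr fun m => ?_
    obtain ⟨N, hN⟩ : ∃ N, p ^ m = N + 1 :=
      ⟨p ^ m - 1, (Nat.sub_add_cancel (Nat.one_le_pow _ _ hp.out.pos)).symm⟩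
    have h1 := Nat.add_one_mul_choose_eq N n
    have h2 := Nat.choose_succ_succ N n
    have hn : (n : ℚ_[p]) + 1 ≠ 0 := by exact_mod_cast n.succ_ne_zero
    have hN' : (p : ℚ_[p]) ^ m = N + 1 := by exact_mod_cast hN
    rw [hN, hN', Nat.add_sub_cancel, sub_eq_iff_eq_add, div_eq_iff hn]
    rw [h2] at h1
    exact_mod_cast (by linarith : (N + 1) * N.choose n = (N.choose (n + 1) + N.choose n) * (n + 1))

theorem Padic.norm_natCast_inv_le (p : ℕ) [hp : Fact p.Prime] (n : ℕ) :
    ‖((n : ℚ_[p]))⁻¹‖ ≤ n := by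
  rcases Nat.eq_zero_or_pos n with rfl | hn
  · simp
  · have h0 : (n : ℚ_[p]) ≠ 0 := by exact_mod_cast hn.ne'
    rw [norm_inv, Padic.norm_eq_zpow_neg_valuation h0, Padic.valuation_natCast, zpow_neg, inv_inv,
      zpow_natCast]
    exact_mod_cast Nat.le_of_dvd hn pow_padicValNat_dvd

/-- The `p`-adic logarithm of `1 + y`, as a power series in `y`. -/
noncomputable def Padic.logOneAdd {p : ℕ} [Fact p.Prime] (y : ℚ_[p]) : ℚ_[p] :=
  ∑' n : ℕ, (-1) ^ n * y ^ (n + 1) / ((n + 1 : ℕ) : ℚ_[p])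

section
variable {p : ℕ} [hp : Fact p.Prime]

theorem Padic.summable_logOneAdd_bound :
    Summable fun n : ℕ => ((n + 1 : ℕ) : ℝ) * (p : ℝ)⁻¹ ^ n := by
  have h1 : ‖(p : ℝ)⁻¹‖ < 1 := by
    rw [norm_inv, Real.norm_natCast]
    exact inv_lt_one_of_one_lt₀ (by exact_mod_cast hp.out.one_lt)
  have := (summable_pow_mul_geometric_of_norm_lt_one 1 h1).add
    (summable_geometric_of_norm_lt_one h1)
  refine this.congr fun n => ?_
  push_cast; ring

theorem Padic.norm_logOneAdd_term_le {y c : ℚ_[p]} (hy : ‖y‖ ≤ (p : ℝ)⁻¹) (hc : ‖c‖ ≤ 1)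
    (n : ℕ) : ‖c * y ^ (n + 1) / ((n + 1 : ℕ) : ℚ_[p])‖ ≤
      ‖y‖ * (((n + 1 : ℕ) : ℝ) * (p : ℝ)⁻¹ ^ n) := by
  rw [div_eq_mul_inv, norm_mul, norm_mul, norm_pow, pow_succ]
  calc ‖c‖ * (‖y‖ ^ n * ‖y‖) * ‖(((n + 1 : ℕ) : ℚ_[p]))⁻¹‖
      ≤ 1 * ((p : ℝ)⁻¹ ^ n * ‖y‖) * ((n + 1 : ℕ) : ℝ) := by
        gcongr
        exact Padic.norm_natCast_inv_le p _
    _ = _ := by ring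

theorem Padic.hasSum_logOneAdd {y : ℚ_[p]} (hy : ‖y‖ ≤ (p : ℝ)⁻¹) :
    HasSum (fun n : ℕ => (-1) ^ n * y ^ (n + 1) / ((n + 1 : ℕ) : ℚ_[p])) (logOneAdd y) :=
  (Summable.of_norm_bounded (summable_logOneAdd_bound.mul_left ‖y‖)
    fun n => norm_logOneAdd_term_le hy (by simp) n).hasSum

open Filter Topology in
theorem Padic.tendsto_logOneAdd {y : ℚ_[p]} (hy : ‖y‖ ≤ (p : ℝ)⁻¹) :
    Tendsto (fun m : ℕ => ((1 + y) ^ p ^ m - 1) / (p : ℚ_[p]) ^ m) atTop (𝓝 (logOneAdd y)) := by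
  have key := tendsto_tsum_of_dominated_convergence (𝓕 := atTop)
    (f := fun (m n : ℕ) => ((p ^ m - 1).choose n : ℚ_[p]) * y ^ (n + 1) / ((n + 1 : ℕ) : ℚ_[p]))
    (summable_logOneAdd_bound.mul_left ‖y‖)
    (fun n => ((tendsto_natCast_choose_prime_pow_sub_one p n).mul_const _).div_const _)
    (Eventually.of_forall fun m n => norm_logOneAdd_term_le hy
      (by exact_mod_cast Padic.norm_int_le_one ((p ^ m - 1).choose n : ℤ)) n)
  refine key.congr fun m => ?_
  have hpm : (p : ℚ_[p]) ^ m ≠ 0 := pow_ne_zero _ (by exact_mod_cast hp.out.ne_zero)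
  obtain ⟨N, hN⟩ : ∃ N, p ^ m = N + 1 :=
    ⟨p ^ m - 1, (Nat.sub_add_cancel (Nat.one_le_pow _ _ hp.out.pos)).symm⟩
  have hN' : (p : ℚ_[p]) ^ m = N + 1 := by exact_mod_cast hN
  rw [eq_div_iff hpm, hN', hN, Nat.add_sub_cancel, tsum_eq_sum (s := Finset.range (N + 1)),
    add_comm 1 y, add_pow, Finset.sum_range_succ' _ (N + 1), Finset.sum_mul]
  · simp only [one_pow, mul_one, pow_zero, Nat.choose_zero_right, Nat.cast_one, add_sub_cancel_right]
    refine Finset.sum_congr rfl fun n _ => ?_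
    have h1 : ((N : ℚ_[p]) + 1) * N.choose n = (N + 1).choose (n + 1) * ((n + 1 : ℕ) : ℚ_[p]) := by
      exact_mod_cast Nat.add_one_mul_choose_eq N n
    have hn : ((n + 1 : ℕ) : ℚ_[p]) ≠ 0 := by exact_mod_cast n.succ_ne_zero
    rw [div_mul_eq_mul_div, div_eq_iff hn]
    linear_combination y ^ (n + 1) * h1
  · intro n hn
    rw [Finset.mem_range, not_lt] at hn
    simp [Nat.choose_eq_zero_of_lt (show N < n by omega)]

open Filter Topology in
theorem Padic.logOneAdd_mul {u v : ℚ_[p]} (hu : ‖u - 1‖ ≤ (p : ℝ)⁻¹) (hv : ‖v - 1‖ ≤ (p : ℝ)⁻¹)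
    (huv : ‖u * v - 1‖ ≤ (p : ℝ)⁻¹) :
    logOneAdd (u * v - 1) = logOneAdd (u - 1) + logOneAdd (v - 1) := by
  have Hu := tendsto_logOneAdd hu
  have Hv := tendsto_logOneAdd hv
  have Huv := tendsto_logOneAdd huv
  have hpm : Tendsto (fun m : ℕ => ((p : ℚ_[p])) ^ m) atTop (𝓝 0) :=
    tendsto_pow_atTop_nhds_zero_of_norm_lt_one Padic.norm_p_lt_one
  have H := (hpm.mul (Hu.mul Hv)).add (Hu.add Hv)
  rw [zero_mul, zero_add] at H
  refine tendsto_nhds_unique Huv (H.congr fun m => ?_)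
  have hpm : (p : ℚ_[p]) ^ m ≠ 0 := pow_ne_zero _ (by exact_mod_cast hp.out.ne_zero)
  simp only [add_sub_cancel, mul_pow]
  field_simp
  ring

theorem Padic.norm_logOneAdd (hp2 : 2 < p) {y : ℚ_[p]} (hy : ‖y‖ ≤ (p : ℝ)⁻¹) :
    ‖logOneAdd y‖ = ‖y‖ := by
  rcases eq_or_ne y 0 with rfl | hy0
  · simp [logOneAdd]
  have hs := (hasSum_logOneAdd hy)
  have h0 := hs.summable.tsum_eq_zero_add
  have hb : ∀ n : ℕ, ((n + 1 + 1 : ℕ) : ℝ) * (p : ℝ)⁻¹ ^ (n + 1) ≤ 2 / 3 := by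
    intro n
    have hp3 : (p : ℝ)⁻¹ ≤ 3⁻¹ := by
      gcongr
      exact_mod_cast hp2
    calc ((n + 1 + 1 : ℕ) : ℝ) * (p : ℝ)⁻¹ ^ (n + 1)
        ≤ ((n + 1 + 1 : ℕ) : ℝ) * (3 : ℝ)⁻¹ ^ (n + 1) := by gcongr
      _ ≤ 2 / 3 := by
        induction n with
        | zero => norm_num
        | succ n ih =>
          rw [pow_succ]
          have : (0 : ℝ) < 3⁻¹ ^ (n + 1) := by positivity
          push_cast at ih ⊢
          nlinarith [mul_nonneg (Nat.cast_nonneg (α := ℝ) n) this.le]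
  have htail : ‖∑' n : ℕ, (-1) ^ (n + 1) * y ^ (n + 1 + 1) / ((n + 1 + 1 : ℕ) : ℚ_[p])‖ < ‖y‖ := by
    have hy' : 0 < ‖y‖ := norm_pos_iff.mpr hy0
    refine lt_of_le_of_lt (IsUltrametricDist.norm_tsum_le_of_forall_le_of_nonneg
      (C := ‖y‖ * (2 / 3)) (by positivity) fun n => ?_) (by linarith)
    exact (norm_logOneAdd_term_le hy (by simp) (n + 1)).trans (by gcongr; exact hb n)
  rw [logOneAdd, h0]
  simp only [pow_zero, zero_add, pow_one, one_mul, Nat.cast_one, div_one]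
  rw [IsUltrametricDist.norm_add_eq_max_of_norm_ne_norm htail.ne', max_eq_left htail.le]
end

section
variable {p : ℕ} [hp : Fact p.Prime]

theorem PadicInt.norm_units_coe (u : ℤ_[p]ˣ) : ‖((u : ℤ_[p]) : ℚ_[p])‖ = 1 := by
  rw [PadicInt.padic_norm_e_of_padicInt, PadicInt.norm_units]

/-- The units of `ℤ_[p]` congruent to `1` modulo `p`. -/
def PadicInt.principalUnits (p : ℕ) [Fact p.Prime] : Subgroup ℤ_[p]ˣ where
  carrier := {u | ‖((u : ℤ_[p]) : ℚ_[p]) - 1‖ ≤ (p : ℝ)⁻¹}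
  mul_mem' {u v} hu hv := by
    rw [Set.mem_ofPred_eq] at *
    have h : ((u * v : ℤ_[p]ˣ) : ℚ_[p]) - 1 = (u : ℤ_[p]) * ((v : ℤ_[p]) - 1) + ((u : ℤ_[p]) - 1) := by
      push_cast; ring
    rw [h]
    refine (IsUltrametricDist.norm_add_le_max _ _).trans (max_le ?_ hu)
    rwa [norm_mul, PadicInt.norm_units_coe, one_mul]
  one_mem' := by simp
  inv_mem' {u} hu := by
    rw [Set.mem_ofPred_eq] at *
    have h1 : ((u : ℤ_[p]) : ℚ_[p]) * ((u⁻¹ : ℤ_[p]ˣ) : ℤ_[p]) = 1 := by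
      exact_mod_cast congrArg (Subtype.val) u.mul_inv
    have h : ((u⁻¹ : ℤ_[p]ˣ) : ℚ_[p]) - 1 =
        -((u⁻¹ : ℤ_[p]ˣ) : ℤ_[p]) * ((u : ℤ_[p]) - 1) := by
      linear_combination h1
    rwa [h, norm_mul, norm_neg, PadicInt.norm_units_coe, one_mul]
end

section
variable {K : Type*} [NormedField K]

/-- `F` is given by a power series in `φ` with absolutely summable coefficients of norm at
most `1`. -/
def HasIntegralExpansion {X : Type*} (φ F : X → K) : Prop :=
  ∃ a : ℕ → K, (∀ n, ‖a n‖ ≤ 1) ∧ (Summable fun n => ‖a n‖) ∧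
    ∀ x, HasSum (fun n => a n * φ x ^ n) (F x)

variable {X : Type*} {φ F G : X → K}

theorem norm_mul_pow_le_of_norm_le_one {c z : K} (hz : ‖z‖ ≤ 1) (n : ℕ) : ‖c * z ^ n‖ ≤ ‖c‖ := by
  rw [norm_mul, norm_pow]
  exact mul_le_of_le_one_right (norm_nonneg _) (pow_le_one₀ (norm_nonneg _) hz)

theorem HasIntegralExpansion.const {c : K} (hc : ‖c‖ ≤ 1) :
    HasIntegralExpansion φ fun _ => c := by
  refine ⟨Pi.single 0 c, fun n => ?_, summable_of_ne_finset_zero (s := {0}) fun n hn => ?_,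
    fun x => ?_⟩
  · rcases eq_or_ne n 0 with rfl | hn <;> simp [*]
  · simp only [Finset.mem_singleton] at hn
    simp [hn]
  · convert hasSum_single (f := fun n => (Pi.single 0 c : ℕ → K) n * φ x ^ n) 0 ?_ using 1
    · simp
    · intro n hn
      simp [hn]

theorem HasIntegralExpansion.sub [IsUltrametricDist K] (hF : HasIntegralExpansion φ F)
    (hG : HasIntegralExpansion φ G) : HasIntegralExpansion φ fun x => F x - G x := by
  obtain ⟨a, ha1, has, ha⟩ := hF
  obtain ⟨b, hb1, hbs, hb⟩ := hG
  refine ⟨fun n => a n - b n, fun n => ?_, (has.add hbs).of_nonneg_of_le (fun _ => norm_nonneg _)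
      fun n => norm_sub_le _ _, fun x => ?_⟩
  · beta_reduce
    rw [sub_eq_add_neg]
    exact (IsUltrametricDist.norm_add_le_max _ _).trans
      (max_le (ha1 n) ((norm_neg _).trans_le (hb1 n)))
  · simpa only [sub_mul] using (ha x).sub (hb x)

theorem HasIntegralExpansion.mul [CompleteSpace K] [IsUltrametricDist K]
    (hφ : ∀ x, ‖φ x‖ ≤ 1) (hF : HasIntegralExpansion φ F)
    (hG : HasIntegralExpansion φ G) : HasIntegralExpansion φ fun x => F x * G x := by
  obtain ⟨a, ha1, has, ha⟩ := hF
  obtain ⟨b, hb1, hbs, hb⟩ := hG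
  have hs := summable_norm_sum_mul_antidiagonal_of_summable_norm has hbs
  refine ⟨_, fun n => ?_, hs, fun x => ?_⟩
  · refine IsUltrametricDist.norm_sum_le_of_forall_le_of_nonneg zero_le_one fun kl _ => ?_
    rw [norm_mul]
    exact mul_le_one₀ (ha1 _) (norm_nonneg _) (hb1 _)
  · have hle (c : ℕ → K) (hc : Summable fun n => ‖c n‖) : Summable fun n => ‖c n * φ x ^ n‖ :=
      hc.of_nonneg_of_le (fun _ => norm_nonneg _)
        fun n => norm_mul_pow_le_of_norm_le_one (hφ x) n
    change HasSum _ (F x * G x)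
    rw [← (ha x).tsum_eq, ← (hb x).tsum_eq,
      tsum_mul_tsum_eq_tsum_sum_antidiagonal_of_summable_norm (hle a has) (hle b hbs)]
    refine (hle _ hs).of_norm.hasSum_iff.mpr (tsum_congr fun n => ?_)
    rw [Finset.sum_mul]
    refine Finset.sum_congr rfl fun kl hkl => ?_
    rw [← Finset.HasAntidiagonal.mem_antidiagonal.mp hkl, pow_add]
    ring

theorem HasIntegralExpansion.prod_sub_natCast [CompleteSpace K] [IsUltrametricDist K]
    (hφ : ∀ x, ‖φ x‖ ≤ 1) (hF : HasIntegralExpansion φ F) (n : ℕ) :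
    HasIntegralExpansion φ fun x => ∏ i ∈ Finset.range n, (F x - i) := by
  induction n with
  | zero => simpa using HasIntegralExpansion.const (φ := φ) (c := 1) (by simp)
  | succ n ih =>
    simp only [Finset.prod_range_succ]
    exact ih.mul hφ (hF.sub (.const (IsUltrametricDist.norm_natCast_le_one K n)))

open Filter Topology in
theorem exists_tsum_eq_of_hasIntegralExpansion [CompleteSpace K] [IsUltrametricDist K]
    (hφ : ∀ x, ‖φ x‖ ≤ 1) {F : ℕ → X → K} (hF : ∀ n, HasIntegralExpansion φ (F n)) {c : ℕ → K}
    (hc : Tendsto c atTop (𝓝 0)) :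
    ∃ a : ℕ → K, ∀ x, ∑' n, c n * F n x = ∑' k, a k * φ x ^ k := by
  choose b hb1 hbs hb using hF
  refine ⟨fun k => ∑' n, c n * b n k, fun x => ?_⟩
  have hsum : Summable (Function.uncurry fun n k => c n * b n k * φ x ^ k) := by
    refine NonarchimedeanAddGroup.summable_of_tendsto_cofinite_zero ?_
    rw [Metric.tendsto_nhds]
    intro ε hε
    have h1 : {n | ε ≤ ‖c n‖}.Finite := by
      have := (Metric.tendsto_nhds.mp hc) ε hε
      rw [← Nat.cofinite_eq_atTop, eventually_cofinite] at this
      simpa using this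
    have h2 (n : ℕ) : {k | ε ≤ ‖c n * b n k‖}.Finite := by
      have h0 : Tendsto (fun k => c n * b n k) atTop (𝓝 0) := by
        simpa using (hbs n).of_norm.tendsto_atTop_zero.const_mul (c n)
      have := (Metric.tendsto_nhds.mp h0) ε hε
      rw [← Nat.cofinite_eq_atTop, eventually_cofinite] at this
      simpa using this
    rw [eventually_cofinite]
    refine (h1.biUnion fun n _ => (h2 n).image (Prod.mk n)).subset ?_
    rintro ⟨n, k⟩ h
    simp only [Function.uncurry_apply_pair, dist_zero_right, not_lt, Set.mem_ofPred_eq] at h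
    have h' : ε ≤ ‖c n * b n k‖ := h.trans (norm_mul_pow_le_of_norm_le_one (hφ x) k)
    have h'' : ε ≤ ‖c n‖ := by
      rw [norm_mul] at h'
      exact h'.trans (mul_le_of_le_one_right (norm_nonneg _) (hb1 n k))
    simp only [Set.mem_iUnion, Set.mem_image]
    exact ⟨n, h'', k, h', rfl⟩
  calc ∑' n, c n * F n x = ∑' n, ∑' k, c n * b n k * φ x ^ k := by
        refine tsum_congr fun n => ?_
        rw [← (hb n x).tsum_eq, ← tsum_mul_left]
        exact tsum_congr fun k => (mul_assoc _ _ _).symm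
    _ = ∑' k, ∑' n, c n * b n k * φ x ^ k := hsum.tsum_comm.symm
    _ = _ := tsum_congr fun k => tsum_mul_right

theorem norm_one_add_pow_prime_sub_one_le [IsUltrametricDist K] {p : ℕ} (hp : p.Prime) {d : K}
    (hd : ‖d‖ ≤ 1) : ‖(1 + d) ^ p - 1‖ ≤ max (‖d‖ ^ p) (‖(p : K)‖ * ‖d‖) := by
  rw [add_comm 1 d, add_pow, Finset.sum_range_succ']
  simp only [one_pow, mul_one, pow_zero, Nat.choose_zero_right, Nat.cast_one, add_sub_cancel_right]
  refine IsUltrametricDist.norm_sum_le_of_forall_le_of_nonneg (by positivity) fun k hk => ?_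
  rw [Finset.mem_range] at hk
  rcases eq_or_ne (k + 1) p with h | h
  · refine le_max_of_le_left ?_
    simp [h]
  · refine le_max_of_le_right ?_
    obtain ⟨m, hm⟩ := hp.dvd_choose_self k.succ_ne_zero (by omega : k + 1 < p)
    rw [norm_mul, hm, Nat.cast_mul, norm_mul, norm_pow, pow_succ]
    have h1 := IsUltrametricDist.norm_natCast_le_one K m
    have h2 := pow_le_one₀ (n := k) (norm_nonneg d) hd
    calc ‖d‖ ^ k * ‖d‖ * (‖(p : K)‖ * ‖(m : K)‖) ≤ 1 * ‖d‖ * (‖(p : K)‖ * 1) := by gcongr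
      _ = _ := by ring

theorem norm_pow_prime_pow_sub_one_lt [IsUltrametricDist K] {p : ℕ} (hp : p.Prime)
    (hpK : ‖(p : K)‖ = (p : ℝ)⁻¹) {r : ℕ} (hr : 1 ≤ r) {z : K}
    (hz : ‖z - 1‖ < (p : ℝ) ^ (-(1 / ((p : ℝ) ^ (r - 1) * ((p : ℝ) + 1))))) (s : ℕ) (hs : s ≤ r) :
    ‖z ^ p ^ s - 1‖ < (p : ℝ) ^ (-((p : ℝ) ^ s / ((p : ℝ) ^ (r - 1) * ((p : ℝ) + 1)))) := by
  have hp1 : (1 : ℝ) < p := by exact_mod_cast hp.one_lt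
  have hp0 : (0 : ℝ) < p := by linarith
  have hD : (0 : ℝ) < (p : ℝ) ^ (r - 1) * ((p : ℝ) + 1) := by positivity
  induction s with
  | zero => simpa using hz
  | succ s ih =>
    have ih := ih (by omega)
    set D := (p : ℝ) ^ (r - 1) * ((p : ℝ) + 1) with hDdef
    set B := (p : ℝ) ^ (-((p : ℝ) ^ s / D)) with hB
    have hB1 : B ≤ 1 := Real.rpow_le_one_of_one_le_of_nonpos hp1.le
      (neg_nonpos.mpr (by positivity))
    have hd : ‖z ^ p ^ s - 1‖ ≤ 1 := ih.le.trans hB1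
    have h := norm_one_add_pow_prime_sub_one_le hp hd
    rw [add_sub_cancel, ← pow_mul, ← pow_succ, hpK] at h
    refine h.trans_lt (max_lt ?_ ?_)
    · refine (pow_lt_pow_left₀ ih (norm_nonneg _) hp.ne_zero).trans_eq ?_
      rw [hB, ← Real.rpow_mul_natCast hp0.le]
      congr 1
      ring
    · calc (p : ℝ)⁻¹ * ‖z ^ p ^ s - 1‖ < (p : ℝ)⁻¹ * B := by gcongr
        _ = (p : ℝ) ^ (-1 - (p : ℝ) ^ s / D) := by
          rw [sub_eq_add_neg, Real.rpow_add hp0, Real.rpow_neg_one]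
        _ ≤ _ := by
          refine Real.rpow_le_rpow_of_exponent_le hp1.le ?_
          have hsr : (p : ℝ) ^ s ≤ (p : ℝ) ^ (r - 1) := pow_le_pow_right₀ hp1.le (by omega)
          have : (p : ℝ) ^ (s + 1) / D ≤ 1 + (p : ℝ) ^ s / D := by
            rw [div_le_iff₀ hD, add_mul, one_mul, div_mul_cancel₀ _ hD.ne', hDdef, pow_succ]
            nlinarith [pow_pos hp0 s, pow_pos hp0 (r - 1)]
          linarith
end

open Filter Topology in
theorem tendsto_pow_div_factorial_of_norm_sq_mul_lt_one {p : ℕ} [hp : Fact p.Prime] (hp2 : 2 < p)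
    {K : Type*} [NormedField K] [NormedAlgebra ℚ_[p] K] {d : K} (hd : ‖d‖ ^ 2 * p < 1) :
    Tendsto (fun n : ℕ => d ^ n / (n.factorial : K)) atTop (𝓝 0) := by
  have hb (n : ℕ) : ‖d ^ n / (n.factorial : K)‖ ^ 2 ≤ (‖d‖ ^ 2 * p) ^ n := by
    have hf : (n.factorial : ℚ_[p]) ≠ 0 := by exact_mod_cast n.factorial_ne_zero
    have h1 : ‖(n.factorial : K)‖⁻¹ = (p : ℝ) ^ padicValNat p n.factorial := by
      rw [← map_natCast (algebraMap ℚ_[p] K), norm_algebraMap', Padic.norm_eq_zpow_neg_valuation hf,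
        Padic.valuation_natCast, zpow_neg, inv_inv, zpow_natCast]
    have h2 : padicValNat p n.factorial * 2 ≤ n := by
      have h3 := sub_one_mul_padicValNat_factorial (p := p) n
      have h4 : 2 * padicValNat p n.factorial ≤ (p - 1) * padicValNat p n.factorial :=
        Nat.mul_le_mul_right _ (by omega)
      omega
    rw [div_eq_mul_inv, norm_mul, norm_pow, norm_inv, h1, mul_pow, mul_pow, ← pow_mul, ← pow_mul,
      ← pow_mul, mul_comm n 2]
    gcongr
    exact_mod_cast hp.out.one_lt.le
  have h0 : Tendsto (fun n : ℕ => ‖d ^ n / (n.factorial : K)‖ ^ 2) atTop (𝓝 0) :=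
    squeeze_zero (fun _ => by positivity) hb
      (tendsto_pow_atTop_nhds_zero_of_lt_one (by positivity) hd)
  rw [tendsto_zero_iff_norm_tendsto_zero]
  simpa only [Real.sqrt_sq (norm_nonneg _), Real.sqrt_zero] using h0.sqrt

theorem pow_div_factorial_mul_prod_sub_natCast {K : Type*} [Field K] [CharZero K] (d : K)
    (k n : ℕ) : d ^ n / (n.factorial : K) * ∏ i ∈ Finset.range n, ((k : K) - i) =
      d ^ n * (k.choose n : K) := by
  have hf : (n.factorial : K) ≠ 0 := by exact_mod_cast n.factorial_ne_zero
  rw [← descPochhammer_eval_eq_prod_range, descPochhammer_eval_eq_descFactorial,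
    Nat.descFactorial_eq_factorial_mul_choose]
  push_cast
  field_simp

open Filter Topology in
theorem tendsto_pow_tsum_prod_sub_natCast {p : ℕ} [Fact p.Prime]
    {K : Type*} [NormedField K] [CompleteSpace K] [NormedAlgebra ℚ_[p] K] [IsUltrametricDist K]
    {η : K} (hη : ‖η - 1‖ < 1) {t : ℚ_[p]} {k : ℕ → ℕ}
    (hk : Tendsto (fun j => (k j : ℚ_[p])) atTop (𝓝 t)) :
    Tendsto (fun j => η ^ k j) atTop (𝓝 (∑' n : ℕ, (η - 1) ^ n / (n.factorial : K) *
      ∏ i ∈ Finset.range n, (algebraMap ℚ_[p] K t - i))) := by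
  have hchar : CharZero K := charZero_of_injective_algebraMap (algebraMap ℚ_[p] K).injective
  have hk' : Tendsto (fun j => (k j : K)) atTop (𝓝 (algebraMap ℚ_[p] K t)) := by
    simpa [Function.comp_def] using
      ((algebraMapCLM ℚ_[p] K).continuous.tendsto t).comp hk
  have hterm (n : ℕ) : Tendsto (fun j => (η - 1) ^ n * ((k j).choose n : K)) atTop
      (𝓝 ((η - 1) ^ n / (n.factorial : K) *
        ∏ i ∈ Finset.range n, (algebraMap ℚ_[p] K t - i))) := by
    simp only [← pow_div_factorial_mul_prod_sub_natCast]
    exact (tendsto_finsetProd (Finset.range n) fun (i : ℕ) _ =>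
      hk'.sub_const (i : K)).const_mul _
  have hbound (j n : ℕ) : ‖(η - 1) ^ n * ((k j).choose n : K)‖ ≤ ‖η - 1‖ ^ n := by
    rw [norm_mul, norm_pow]
    exact mul_le_of_le_one_right (by positivity) (IsUltrametricDist.norm_natCast_le_one K _)
  refine (tendsto_tsum_of_dominated_convergence
    (summable_geometric_of_lt_one (norm_nonneg _) hη) hterm
    (Eventually.of_forall hbound)).congr fun j => ?_
  rw [tsum_eq_sum (s := Finset.range (k j + 1))]
  · conv_rhs => rw [← sub_add_cancel η 1, add_pow]
    simp
  · intro n hn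
    rw [Finset.mem_range, not_lt] at hn
    simp [Nat.choose_eq_zero_of_lt (show k j < n by omega)]

section
variable {p : ℕ} [hp : Fact p.Prime]

/-- The `p`-adic logarithm on principal units. -/
noncomputable def PadicInt.logPrincipalUnits (p : ℕ) [Fact p.Prime] :
    PadicInt.principalUnits p →* Multiplicative ℚ_[p] where
  toFun u := .ofAdd (Padic.logOneAdd ((((u : ℤ_[p]ˣ) : ℤ_[p]) : ℚ_[p]) - 1))
  map_one' := by simp [Padic.logOneAdd]
  map_mul' u v := by
    have huv : ((((u * v : PadicInt.principalUnits p) : ℤ_[p]ˣ) : ℤ_[p]) : ℚ_[p]) =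
        (((u : ℤ_[p]ˣ) : ℤ_[p]) : ℚ_[p]) * (((v : ℤ_[p]ˣ) : ℤ_[p]) : ℚ_[p]) := by
      push_cast
      rfl
    have h := (u * v).2
    change ‖((((u * v : PadicInt.principalUnits p) : ℤ_[p]ˣ) : ℤ_[p]) : ℚ_[p]) - 1‖ ≤ _ at h
    rw [huv] at h ⊢
    rw [← ofAdd_add, ← Padic.logOneAdd_mul u.2 v.2 h]

theorem PadicInt.norm_sub_eq_norm_logOneAdd_sub (hp2 : 2 < p) {u v : ℤ_[p]ˣ}
    (hu : u ∈ PadicInt.principalUnits p) (hv : v ∈ PadicInt.principalUnits p) (n : ℕ) :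
    ‖(v : ℤ_[p]) ^ n - u‖ = ‖(n : ℚ_[p]) * Padic.logOneAdd (((v : ℤ_[p]) : ℚ_[p]) - 1) -
      Padic.logOneAdd (((u : ℤ_[p]) : ℚ_[p]) - 1)‖ := by
  let U : PadicInt.principalUnits p := ⟨u, hu⟩
  let V : PadicInt.principalUnits p := ⟨v, hv⟩
  have h1 : PadicInt.logPrincipalUnits p (V ^ n * U⁻¹) =
      .ofAdd ((n : ℚ_[p]) * Padic.logOneAdd (((v : ℤ_[p]) : ℚ_[p]) - 1) -
        Padic.logOneAdd (((u : ℤ_[p]) : ℚ_[p]) - 1)) := by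
    rw [map_mul, map_pow, map_inv, ← nsmul_eq_mul, ofAdd_sub, ofAdd_nsmul, div_eq_mul_inv]
    rfl
  have h2 := Padic.norm_logOneAdd hp2 (V ^ n * U⁻¹).2
  have h3 := congrArg Multiplicative.toAdd h1
  rw [toAdd_ofAdd] at h3
  rw [← h3]
  refine Eq.trans ?_ h2.symm
  have h4 : (v : ℤ_[p]) ^ n - u = u * (((v ^ n * u⁻¹ : ℤ_[p]ˣ) : ℤ_[p]) - 1) := by
    push_cast
    rw [mul_sub, mul_left_comm, Units.mul_inv]
    ring
  rw [h4, norm_mul, PadicInt.norm_units, one_mul, ← PadicInt.padic_norm_e_of_padicInt]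
  simp [U, V]

theorem PadicInt.logOneAdd_pow_sub_one {v : ℤ_[p]ˣ} (hv : v ∈ PadicInt.principalUnits p) (n : ℕ) :
    Padic.logOneAdd ((((v ^ n : ℤ_[p]ˣ) : ℤ_[p]) : ℚ_[p]) - 1) =
      (n : ℚ_[p]) * Padic.logOneAdd (((v : ℤ_[p]) : ℚ_[p]) - 1) := by
  have h := congrArg Multiplicative.toAdd (map_pow (PadicInt.logPrincipalUnits p) ⟨v, hv⟩ n)
  rw [toAdd_pow, nsmul_eq_mul] at h
  exact h

theorem Padic.hasIntegralExpansion_logOneAdd_div {K : Type*} [NormedField K]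
    [NormedAlgebra ℚ_[p] K] {q M : ℚ_[p]} (hq : ‖q‖ ≤ (p : ℝ)⁻¹) (hM : ‖M‖ = ‖q‖) :
    HasIntegralExpansion (fun x : ℤ_[p] => algebraMap ℚ_[p] K x)
      fun x => algebraMap ℚ_[p] K (logOneAdd (q * (x : ℚ_[p])) / M) := by
  have hp1 : (p : ℝ)⁻¹ ≤ 2⁻¹ := by
    gcongr
    exact_mod_cast hp.out.two_le
  have hb (n : ℕ) : ‖(-1) ^ n * q ^ (n + 1) / ((n + 1 : ℕ) : ℚ_[p]) / M‖ ≤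
      ((n + 1 : ℕ) : ℝ) * (p : ℝ)⁻¹ ^ n := by
    rw [norm_div _ M, hM]
    exact div_le_of_le_mul₀ (norm_nonneg _) (by positivity)
      ((norm_logOneAdd_term_le hq (by simp) n).trans_eq (mul_comm _ _))
  have hb1 (n : ℕ) : ((n + 1 : ℕ) : ℝ) * (p : ℝ)⁻¹ ^ n ≤ 1 := by
    calc ((n + 1 : ℕ) : ℝ) * (p : ℝ)⁻¹ ^ n ≤ ((n + 1 : ℕ) : ℝ) * (2⁻¹ : ℝ) ^ n := by gcongr
      _ ≤ 1 := by
        rw [inv_pow, mul_inv_le_iff₀ (by positivity), one_mul]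
        exact_mod_cast n.lt_two_pow_self
  refine ⟨fun n => n.casesOn 0 fun n =>
    algebraMap ℚ_[p] K ((-1) ^ n * q ^ (n + 1) / ((n + 1 : ℕ) : ℚ_[p]) / M), fun n => ?_, ?_,
    fun x => ?_⟩
  · cases n with
    | zero => simp
    | succ n =>
      rw [norm_algebraMap']
      exact (hb n).trans (hb1 n)
  · rw [← summable_nat_add_iff 1]
    refine (summable_logOneAdd_bound (p := p)).of_nonneg_of_le (fun _ => norm_nonneg _) fun n => ?_
    rw [norm_algebraMap']
    exact hb n
  · rw [← hasSum_nat_add_iff' 1]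
    have hqx : ‖q * x‖ ≤ (p : ℝ)⁻¹ := by
      rw [norm_mul]
      exact (mul_le_of_le_one_right (norm_nonneg _) (PadicInt.norm_le_one x)).trans hq
    have h := ((hasSum_logOneAdd hqx).div_const M).map (algebraMap ℚ_[p] K)
      (algebraMapCLM ℚ_[p] K).continuous
    rw [Finset.sum_range_one]
    change HasSum _ (_ - 0 * _)
    rw [zero_mul, sub_zero]
    refine h.congr_fun fun n => ?_
    rw [Function.comp_apply, ← map_pow, ← map_mul]
    congr 1
    ring
end

open Filter Topology in
/-- Let `p > 2` be prime, `K` a finite extension of `ℚ_p` and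
`χ : ℤ_pˣ → Kˣ` a continuous character.  For an integer `r ≥ 1`, if
`|χ(1+p) - 1| < p^(-1/(p^(r-1)(p+1)))` then the map `x ↦ χ(1 + p^(r+1) x)` on `ℤ_p`
is analytic, i.e. given by a single convergent power series. -/
theorem stmt7 (p : ℕ) [Fact p.Prime] (hp : 2 < p) (K : Type*) [NormedField K]
    [CompleteSpace K] [NormedAlgebra ℚ_[p] K] [FiniteDimensional ℚ_[p] K]
    (χ : ℤ_[p]ˣ →* Kˣ) (hχ : Continuous fun u : ℤ_[p]ˣ => (χ u : K))
    (r : ℕ) (hr : 1 ≤ r)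
    (hadm : ∀ u : ℤ_[p]ˣ, (u : ℤ_[p]) = 1 + (p : ℤ_[p]) →
      ‖(χ u : K) - 1‖ < (p : ℝ) ^ (-(1 / ((p : ℝ) ^ (r - 1) * ((p : ℝ) + 1))))) :
    ∃ a : ℕ → K, ∀ (x : ℤ_[p]) (u : ℤ_[p]ˣ),
      (u : ℤ_[p]) = 1 + (p : ℤ_[p]) ^ (r + 1) * x →
      (χ u : K) = ∑' n : ℕ, a n * (algebraMap ℚ_[p] K ((x : ℚ_[p]))) ^ n := by
  have hpp : p.Prime := Fact.out
  have hp0 : (0 : ℝ) < p := by exact_mod_cast hpp.pos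
  have hp1 : (1 : ℝ) < p := by exact_mod_cast hpp.one_lt
  have : IsUltrametricDist K := IsUltrametricDist.of_normedAlgebra ℚ_[p]
  have hpK : ‖(p : K)‖ = (p : ℝ)⁻¹ := by
    rw [← map_natCast (algebraMap ℚ_[p] K), norm_algebraMap', Padic.norm_p]
  obtain ⟨g, hg⟩ : IsUnit (1 + (p : ℤ_[p])) := by
    rw [PadicInt.isUnit_iff, IsUltrametricDist.norm_add_eq_max_of_norm_ne_norm]
    · simpa using (inv_lt_one_of_one_lt₀ hp1).le
    · simpa using (inv_lt_one_of_one_lt₀ hp1).ne'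
  have hg1 : ((g : ℤ_[p]) : ℚ_[p]) - 1 = p := by
    rw [hg]
    push_cast
    ring
  have hgP : g ∈ PadicInt.principalUnits p := by
    change ‖((g : ℤ_[p]) : ℚ_[p]) - 1‖ ≤ (p : ℝ)⁻¹
    rw [hg1, Padic.norm_p]
  set q : ℚ_[p] := (p : ℚ_[p]) ^ (r + 1) with hqdef
  set M : ℚ_[p] := (p : ℚ_[p]) ^ r * Padic.logOneAdd (p : ℚ_[p]) with hMdef
  have hM : ‖M‖ = ‖q‖ := by
    rw [hMdef, hqdef, norm_mul, Padic.norm_logOneAdd hp Padic.norm_p.le, ← norm_mul, pow_succ]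
  have hM0 : M ≠ 0 := by
    rw [← norm_ne_zero_iff, hM, norm_ne_zero_iff]
    exact pow_ne_zero _ (by exact_mod_cast hpp.ne_zero)
  have hq : ‖q‖ ≤ (p : ℝ)⁻¹ := by
    rw [hqdef, norm_pow, Padic.norm_p]
    exact pow_le_of_le_one (by positivity) (inv_lt_one_of_one_lt₀ hp1).le r.succ_ne_zero
  set η : K := (χ (g ^ p ^ r) : K) with hηdef
  have hη : ‖η - 1‖ < (p : ℝ) ^ (-((p : ℝ) / ((p : ℝ) + 1))) := by
    have h := norm_pow_prime_pow_sub_one_lt hpp hpK hr (hadm g hg) r le_rfl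
    obtain ⟨s, rfl⟩ : ∃ s, r = s + 1 := ⟨r - 1, by omega⟩
    rw [Nat.add_sub_cancel, pow_succ (p : ℝ), mul_div_mul_left _ _ (by positivity)] at h
    simpa [hηdef] using h
  have hη1 : ‖η - 1‖ < 1 := hη.trans_le
    (Real.rpow_le_one_of_one_le_of_nonpos hp1.le (neg_nonpos.mpr (by positivity)))
  have hη2 : ‖η - 1‖ ^ 2 * p < 1 := by
    calc ‖η - 1‖ ^ 2 * p < ((p : ℝ) ^ (-((p : ℝ) / ((p : ℝ) + 1)))) ^ 2 * p := by gcongr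
      _ = (p : ℝ) ^ (-((p : ℝ) / ((p : ℝ) + 1)) * 2 + 1) := by
        rw [Real.rpow_add hp0, Real.rpow_one, ← Real.rpow_mul_natCast hp0.le]
        rfl
      _ ≤ 1 := by
        refine Real.rpow_le_one_of_one_le_of_nonpos hp1.le ?_
        have : (1 : ℝ) / 2 ≤ p / (p + 1) := by
          rw [div_le_div_iff₀ two_pos (by positivity)]
          linarith
        linarith
  have hφ (x : ℤ_[p]) : ‖algebraMap ℚ_[p] K x‖ ≤ 1 := by
    rw [norm_algebraMap']
    exact PadicInt.norm_le_one x
  have hF := Padic.hasIntegralExpansion_logOneAdd_div (K := K) hq hM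
  obtain ⟨a, ha⟩ := exists_tsum_eq_of_hasIntegralExpansion hφ (hF.prod_sub_natCast hφ)
    (tendsto_pow_div_factorial_of_norm_sq_mul_lt_one hp hη2)
  refine ⟨a, fun x u hu => ?_⟩
  rw [← ha x]
  have hu1 : ((u : ℤ_[p]) : ℚ_[p]) - 1 = q * x := by
    rw [hu]
    push_cast
    ring
  have hqx : ‖q * x‖ ≤ ‖q‖ := by
    rw [norm_mul]
    exact mul_le_of_le_one_right (norm_nonneg _) (PadicInt.norm_le_one x)
  have huP : u ∈ PadicInt.principalUnits p := by
    change ‖((u : ℤ_[p]) : ℚ_[p]) - 1‖ ≤ (p : ℝ)⁻¹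
    rw [hu1]
    exact hqx.trans hq
  have ht : ‖Padic.logOneAdd (q * (x : ℚ_[p])) / M‖ ≤ 1 := by
    rw [norm_div, hM, Padic.norm_logOneAdd hp (hqx.trans hq)]
    exact div_le_one_of_le₀ hqx (norm_nonneg _)
  set T : ℤ_[p] := ⟨_, ht⟩ with hTdef
  obtain ⟨w, hw, hwT⟩ := mem_closure_iff_seq_limit.mp (PadicInt.denseRange_natCast T)
  choose k hk using hw
  have hkT : Tendsto (fun j => (k j : ℚ_[p])) atTop (𝓝 (Padic.logOneAdd (q * (x : ℚ_[p])) / M)) := by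
    have h : Tendsto (fun j => (w j : ℚ_[p])) atTop (𝓝 (T : ℚ_[p])) :=
      (continuous_subtype_val.tendsto T).comp hwT
    refine h.congr fun j => ?_
    rw [← hk j, PadicInt.coe_natCast]
  have hG (j : ℕ) : ‖((g ^ p ^ r : ℤ_[p]ˣ) : ℤ_[p]) ^ k j - u‖ =
      ‖(k j : ℚ_[p]) * M - Padic.logOneAdd (q * (x : ℚ_[p]))‖ := by
    rw [PadicInt.norm_sub_eq_norm_logOneAdd_sub hp huP (pow_mem hgP _),
      PadicInt.logOneAdd_pow_sub_one hgP, hg1, hu1]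
    push_cast
    rfl
  have hlim : Tendsto (fun j => (g ^ p ^ r) ^ k j) atTop (𝓝 u) := by
    rw [Units.isOpenEmbedding_val.tendsto_nhds_iff, tendsto_iff_norm_sub_tendsto_zero]
    have h := ((hkT.mul_const M).sub_const (Padic.logOneAdd (q * (x : ℚ_[p])))).norm
    rw [div_mul_cancel₀ _ hM0, sub_self, norm_zero] at h
    refine h.congr fun j => ?_
    rw [← hG]
    simp
  refine tendsto_nhds_unique ((hχ.tendsto u).comp hlim)
    ((tendsto_pow_tsum_prod_sub_natCast hη1 hkT).congr fun j => ?_)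
  simp [hηdef]
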